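/- arXiv:1910.12153 — 9 statements merged into one kernel-verified Lean document; each statement's English description precedes it below -/
import Mathlib

section
/- The shifted Loewner matrix satisfies the Sylvester equation 𝕃_sΛ − M𝕃_s = L*WΛ − MV*R. -/
open Matrix

/-- The shifted Loewner matrix satisfies the Sylvester equation
`𝕃ₛΛ − M𝕃ₛ = L*WΛ − MV*R`. -/
theorem shifted_loewner_sylvester
    (m p ν ϱ : ℕ) (hm : 0 < m) (hp : 0 < p) (hν : 0 < ν) (hϱ : 0 < ϱ)
    (lam : Fin ϱ → ℂ) (mu : Fin ν → ℂ)
    (r : Fin ϱ → Fin m → ℂ) (w : Fin ϱ → Fin p → ℂ)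
    (ell : Fin ν → Fin p → ℂ) (v : Fin ν → Fin m → ℂ)
    (hdisj : ∀ i j, mu i ≠ lam j)
    (𝕃s : Matrix (Fin ν) (Fin ϱ) ℂ)
    (h𝕃s : ∀ i j, 𝕃s i j =
      (mu i * (star (v i) ⬝ᵥ r j) - lam j * (star (ell i) ⬝ᵥ w j)) / (mu i - lam j))
    (Λ : Matrix (Fin ϱ) (Fin ϱ) ℂ) (hΛ : Λ = Matrix.diagonal lam)
    (M : Matrix (Fin ν) (Fin ν) ℂ) (hM : M = Matrix.diagonal mu)
    (R : Matrix (Fin m) (Fin ϱ) ℂ) (hR : ∀ k j, R k j = r j k)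
    (W : Matrix (Fin p) (Fin ϱ) ℂ) (hW : ∀ k j, W k j = w j k)
    (L : Matrix (Fin p) (Fin ν) ℂ) (hL : ∀ k i, L k i = ell i k)
    (V : Matrix (Fin m) (Fin ν) ℂ) (hV : ∀ k i, V k i = v i k) :
    𝕃s * Λ - M * 𝕃s = Lᴴ * W * Λ - M * (Vᴴ * R) := by
  subst hΛ hM
  ext i j
  have hvr : (Vᴴ * R) i j = star (v i) ⬝ᵥ r j := by
    simp [Matrix.mul_apply, dotProduct, hV, hR]
  have hlw : (Lᴴ * W) i j = star (ell i) ⬝ᵥ w j := by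
    simp [Matrix.mul_apply, dotProduct, hL, hW]
  rw [Matrix.sub_apply, Matrix.sub_apply, Matrix.mul_diagonal, Matrix.mul_diagonal,
    Matrix.diagonal_mul, Matrix.diagonal_mul, hvr, hlw, h𝕃s]
  have hne : mu i - lam j ≠ 0 := sub_ne_zero.mpr (hdisj i j)
  field_simp
  ring
end

section
/- The Loewner and shifted Loewner matrices satisfy 𝕃_s − M𝕃 = L*W. -/
open Matrix

/-- The Loewner and shifted Loewner matrices satisfy `𝕃ₛ − M𝕃 = L*W`. -/
theorem shifted_loewner_sub_mu_loewner
    (m p ν ϱ : ℕ) (hm : 0 < m) (hp : 0 < p) (hν : 0 < ν) (hϱ : 0 < ϱ)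
    (lam : Fin ϱ → ℂ) (mu : Fin ν → ℂ)
    (r : Fin ϱ → Fin m → ℂ) (w : Fin ϱ → Fin p → ℂ)
    (ell : Fin ν → Fin p → ℂ) (v : Fin ν → Fin m → ℂ)
    (hdisj : ∀ i j, mu i ≠ lam j)
    (𝕃 : Matrix (Fin ν) (Fin ϱ) ℂ)
    (h𝕃 : ∀ i j, 𝕃 i j = (star (v i) ⬝ᵥ r j - star (ell i) ⬝ᵥ w j) / (mu i - lam j))
    (𝕃s : Matrix (Fin ν) (Fin ϱ) ℂ)
    (h𝕃s : ∀ i j, 𝕃s i j =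
      (mu i * (star (v i) ⬝ᵥ r j) - lam j * (star (ell i) ⬝ᵥ w j)) / (mu i - lam j))
    (M : Matrix (Fin ν) (Fin ν) ℂ) (hM : M = Matrix.diagonal mu)
    (W : Matrix (Fin p) (Fin ϱ) ℂ) (hW : ∀ k j, W k j = w j k)
    (L : Matrix (Fin p) (Fin ν) ℂ) (hL : ∀ k i, L k i = ell i k) :
    𝕃s - M * 𝕃 = Lᴴ * W := by
  subst hM
  ext i j
  have hne : mu i - lam j ≠ 0 := sub_ne_zero.mpr (hdisj i j)
  have hLW : (Lᴴ * W) i j = star (ell i) ⬝ᵥ w j := by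
    simp [Matrix.mul_apply, dotProduct, hW, hL]
  rw [hLW, Matrix.sub_apply, Matrix.diagonal_mul, h𝕃, h𝕃s]
  field_simp
  ring
end

section
/- Suppose ν = ϱ = n and 𝕃 is invertible. Let z ∈ ℂ be distinct from all λ_j, set Υ(z) = (zI_n − Λ)^{-1} 𝕃^{-1} V* ∈ ℂ^{n×m}, and suppose the m×m matrix I_m − RΥ(z) is invertible. Then z𝕃 − 𝕃_s is invertible and (z𝕃 − 𝕃_s)^{-1} = Θ(z) 𝕃^{-1}, where Θ(z) = (I_n + Υ(z)(I_m − RΥ(z))^{-1} R)(zI_n − Λ)^{-1}. -/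
open Matrix

/-- The push-through formula for the inverse of `1 - A * B` in terms of that of `1 - B * A`. -/
theorem one_sub_mul_mul_one_add_mul_inv_mul {m n K : Type*} [Fintype m] [DecidableEq m]
    [Fintype n] [DecidableEq n] [CommRing K] (A : Matrix n m K) (B : Matrix m n K)
    (h : IsUnit (1 - B * A)) :
    (1 - A * B) * (1 + A * (1 - B * A)⁻¹ * B) = 1 := by
  have hswap : (1 - A * B) * A = A * (1 - B * A) := by
    simp only [Matrix.sub_mul, Matrix.mul_sub, Matrix.one_mul, Matrix.mul_one, Matrix.mul_assoc]
  rw [Matrix.mul_add, Matrix.mul_one, Matrix.mul_assoc A, ← Matrix.mul_assoc (1 - A * B), hswap,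
    Matrix.mul_assoc A,
    Matrix.mul_nonsing_inv_cancel_left _ _ ((Matrix.isUnit_iff_isUnit_det _).mp h),
    sub_add_cancel]

/-- If `𝕃` is invertible, `z` avoids the right interpolation points, and
`I − RΥ(z)` is invertible with `Υ(z) = (zI − Λ)⁻¹𝕃⁻¹V*`, then `z𝕃 − 𝕃ₛ` is
invertible and `(z𝕃 − 𝕃ₛ)⁻¹ = Θ(z)𝕃⁻¹`, where
`Θ(z) = (I + Υ(z)(I − RΥ(z))⁻¹R)(zI − Λ)⁻¹`. -/
theorem loewner_pencil_inverse
    (m p n : ℕ) (hm : 0 < m) (hp : 0 < p) (hn : 0 < n)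
    (lam : Fin n → ℂ) (mu : Fin n → ℂ)
    (r : Fin n → Fin m → ℂ) (w : Fin n → Fin p → ℂ)
    (ell : Fin n → Fin p → ℂ) (v : Fin n → Fin m → ℂ)
    (hdisj : ∀ i j, mu i ≠ lam j)
    (𝕃 : Matrix (Fin n) (Fin n) ℂ)
    (h𝕃 : ∀ i j, 𝕃 i j = (star (v i) ⬝ᵥ r j - star (ell i) ⬝ᵥ w j) / (mu i - lam j))
    (𝕃s : Matrix (Fin n) (Fin n) ℂ)
    (h𝕃s : ∀ i j, 𝕃s i j =
      (mu i * (star (v i) ⬝ᵥ r j) - lam j * (star (ell i) ⬝ᵥ w j)) / (mu i - lam j))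
    (Λ : Matrix (Fin n) (Fin n) ℂ) (hΛ : Λ = Matrix.diagonal lam)
    (R : Matrix (Fin m) (Fin n) ℂ) (hR : ∀ k j, R k j = r j k)
    (V : Matrix (Fin m) (Fin n) ℂ) (hV : ∀ k i, V k i = v i k)
    (h𝕃inv : IsUnit 𝕃)
    (z : ℂ) (hz : ∀ j, z ≠ lam j)
    (Υ : Matrix (Fin n) (Fin m) ℂ)
    (hΥ : Υ = (z • (1 : Matrix (Fin n) (Fin n) ℂ) - Λ)⁻¹ * 𝕃⁻¹ * Vᴴ)
    (hRΥ : IsUnit ((1 : Matrix (Fin m) (Fin m) ℂ) - R * Υ))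
    (Θ : Matrix (Fin n) (Fin n) ℂ)
    (hΘ : Θ = ((1 : Matrix (Fin n) (Fin n) ℂ) + Υ * ((1 : Matrix (Fin m) (Fin m) ℂ) - R * Υ)⁻¹ * R) *
      (z • (1 : Matrix (Fin n) (Fin n) ℂ) - Λ)⁻¹) :
    IsUnit (z • 𝕃 - 𝕃s) ∧ (z • 𝕃 - 𝕃s)⁻¹ = Θ * 𝕃⁻¹ := by
  have hD : IsUnit (z • (1 : Matrix (Fin n) (Fin n) ℂ) - Λ) := by
    subst hΛ
    rw [Matrix.smul_one_eq_diagonal, Matrix.diagonal_sub, Matrix.isUnit_diagonal, Pi.isUnit_iff]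
    exact fun j => (sub_ne_zero.mpr (hz j)).isUnit
  have hSylvester : 𝕃s = 𝕃 * Λ + Vᴴ * R := by
    subst hΛ
    ext i j
    have hVR : (Vᴴ * R) i j = star (v i) ⬝ᵥ r j := by
      simp [Matrix.mul_apply, dotProduct, hV, hR]
    have hij : mu i - lam j ≠ 0 := sub_ne_zero.mpr (hdisj i j)
    rw [Matrix.add_apply, hVR, Matrix.mul_diagonal, h𝕃, h𝕃s]
    field_simp
    ring
  set D := z • (1 : Matrix (Fin n) (Fin n) ℂ) - Λ with hDdef
  have hDdet := (Matrix.isUnit_iff_isUnit_det _).mp hD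
  have h𝕃det := (Matrix.isUnit_iff_isUnit_det _).mp h𝕃inv
  have hfactor : z • 𝕃 - 𝕃s = 𝕃 * D * (1 - Υ * R) := by
    have hDΥ : 𝕃 * D * Υ = Vᴴ := by
      rw [hΥ, Matrix.mul_assoc D⁻¹, Matrix.mul_assoc 𝕃,
        Matrix.mul_nonsing_inv_cancel_left _ _ hDdet,
        Matrix.mul_nonsing_inv_cancel_left _ _ h𝕃det]
    rw [Matrix.mul_sub, Matrix.mul_one, ← Matrix.mul_assoc, hDΥ, hSylvester, hDdef,
      Matrix.mul_sub, Matrix.mul_smul, Matrix.mul_one, sub_sub]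
  have hright : (z • 𝕃 - 𝕃s) * (Θ * 𝕃⁻¹) = 1 := by
    have hpush := one_sub_mul_mul_one_add_mul_inv_mul Υ R hRΥ
    rw [hfactor, hΘ, Matrix.mul_assoc _ D⁻¹, Matrix.mul_assoc (𝕃 * D), ← Matrix.mul_assoc (1 - Υ * R),
      hpush, Matrix.one_mul, Matrix.mul_assoc 𝕃, Matrix.mul_nonsing_inv_cancel_left _ _ hDdet,
      Matrix.mul_nonsing_inv _ h𝕃det]
  exact ⟨IsUnit.of_mul_eq_one _ hright, Matrix.inv_eq_right_inv hright⟩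
end

section
/- Suppose ν = ϱ = n and, for a fixed index i ∈ {1,…,n}, the matrix λ_i𝕃 − 𝕃_s is invertible. Define the Loewner realization Ê = −𝕃, Â = −𝕃_s, B̂ = V*, Ĉ = W, with transfer function Ĥ(z) = Ĉ(zÊ − Â)^{-1}B̂. Then the right tangential interpolation condition holds: Ĥ(λ_i) r_i = w_i. -/
open Matrix

/-- The Loewner realization `Ê = −𝕃`, `Â = −𝕃ₛ`, `B̂ = V*`, `Ĉ = W` with
transfer function `Ĥ(z) = Ĉ(zÊ − Â)⁻¹B̂` satisfies the right tangential
interpolation condition `Ĥ(λᵢ)rᵢ = wᵢ`, provided `λᵢ𝕃 − 𝕃ₛ` is invertible. -/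
theorem loewner_right_interpolation
    (m p n : ℕ) (hm : 0 < m) (hp : 0 < p) (hn : 0 < n)
    (lam : Fin n → ℂ) (mu : Fin n → ℂ)
    (r : Fin n → Fin m → ℂ) (w : Fin n → Fin p → ℂ)
    (ell : Fin n → Fin p → ℂ) (v : Fin n → Fin m → ℂ)
    (hdisj : ∀ i j, mu i ≠ lam j)
    (𝕃 : Matrix (Fin n) (Fin n) ℂ)
    (h𝕃 : ∀ i j, 𝕃 i j = (star (v i) ⬝ᵥ r j - star (ell i) ⬝ᵥ w j) / (mu i - lam j))
    (𝕃s : Matrix (Fin n) (Fin n) ℂ)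
    (h𝕃s : ∀ i j, 𝕃s i j =
      (mu i * (star (v i) ⬝ᵥ r j) - lam j * (star (ell i) ⬝ᵥ w j)) / (mu i - lam j))
    (R : Matrix (Fin m) (Fin n) ℂ) (hR : ∀ k j, R k j = r j k)
    (W : Matrix (Fin p) (Fin n) ℂ) (hW : ∀ k j, W k j = w j k)
    (V : Matrix (Fin m) (Fin n) ℂ) (hV : ∀ k i, V k i = v i k)
    (i : Fin n) (hinv : IsUnit (lam i • 𝕃 - 𝕃s))
    (Ehat Ahat : Matrix (Fin n) (Fin n) ℂ)
    (Bhat : Matrix (Fin n) (Fin m) ℂ) (Chat : Matrix (Fin p) (Fin n) ℂ)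
    (hE : Ehat = -𝕃) (hA : Ahat = -𝕃s) (hB : Bhat = Vᴴ) (hC : Chat = W) :
    (Chat * (lam i • Ehat - Ahat)⁻¹ * Bhat) *ᵥ r i = w i := by
  subst hE hA hB hC
  have hM : IsUnit (lam i • -𝕃 - -𝕃s).det := by
    rw [← isUnit_iff_isUnit_det, show lam i • -𝕃 - -𝕃s = -(lam i • 𝕃 - 𝕃s) by
      rw [smul_neg, neg_sub_neg, neg_sub]]
    exact hinv.neg
  have hcol : Vᴴ *ᵥ r i = (lam i • -𝕃 - -𝕃s) *ᵥ Pi.single i 1 := by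
    ext k
    have hne : mu k - lam i ≠ 0 := sub_ne_zero.mpr (hdisj k i)
    have hdot : (Vᴴ *ᵥ r i) k = star (v k) ⬝ᵥ r i := by
      simp [mulVec, dotProduct, hV]
    rw [hdot, mulVec_single_one]
    simp only [col_apply, Matrix.sub_apply, Matrix.smul_apply, Matrix.neg_apply, smul_eq_mul, h𝕃, h𝕃s]
    field_simp
    ring
  rw [← mulVec_mulVec, hcol, mulVec_mulVec, Matrix.mul_assoc, nonsing_inv_mul _ hM,
    Matrix.mul_one, mulVec_single_one]
  ext k
  exact hW k i
end

section
/- Suppose ν = ϱ = n and, for a fixed index j ∈ {1,…,n}, the matrix μ_j𝕃 − 𝕃_s is invertible. Define the Loewner realization Ê = −𝕃, Â = −𝕃_s, B̂ = V*, Ĉ = W, with transfer function Ĥ(z) = Ĉ(zÊ − Â)^{-1}B̂. Then the left tangential interpolation condition holds: ℓ_j* Ĥ(μ_j) = v_j*, as an equality of row vectors in ℂ^{1×m}. -/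
open Matrix

/-- The Loewner realization `Ê = −𝕃`, `Â = −𝕃ₛ`, `B̂ = V*`, `Ĉ = W` with
transfer function `Ĥ(z) = Ĉ(zÊ − Â)⁻¹B̂` satisfies the left tangential
interpolation condition `ℓⱼ*Ĥ(μⱼ) = vⱼ*`, provided `μⱼ𝕃 − 𝕃ₛ` is invertible. -/
theorem loewner_left_interpolation
    (m p n : ℕ) (hm : 0 < m) (hp : 0 < p) (hn : 0 < n)
    (lam : Fin n → ℂ) (mu : Fin n → ℂ)
    (r : Fin n → Fin m → ℂ) (w : Fin n → Fin p → ℂ)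
    (ell : Fin n → Fin p → ℂ) (v : Fin n → Fin m → ℂ)
    (hdisj : ∀ i j, mu i ≠ lam j)
    (𝕃 : Matrix (Fin n) (Fin n) ℂ)
    (h𝕃 : ∀ i j, 𝕃 i j = (star (v i) ⬝ᵥ r j - star (ell i) ⬝ᵥ w j) / (mu i - lam j))
    (𝕃s : Matrix (Fin n) (Fin n) ℂ)
    (h𝕃s : ∀ i j, 𝕃s i j =
      (mu i * (star (v i) ⬝ᵥ r j) - lam j * (star (ell i) ⬝ᵥ w j)) / (mu i - lam j))
    (W : Matrix (Fin p) (Fin n) ℂ) (hW : ∀ k j, W k j = w j k)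
    (V : Matrix (Fin m) (Fin n) ℂ) (hV : ∀ k i, V k i = v i k)
    (j : Fin n) (hinv : IsUnit (mu j • 𝕃 - 𝕃s))
    (Ehat Ahat : Matrix (Fin n) (Fin n) ℂ)
    (Bhat : Matrix (Fin n) (Fin m) ℂ) (Chat : Matrix (Fin p) (Fin n) ℂ)
    (hE : Ehat = -𝕃) (hA : Ahat = -𝕃s) (hB : Bhat = Vᴴ) (hC : Chat = W) :
    star (ell j) ᵥ* (Chat * (mu j • Ehat - Ahat)⁻¹ * Bhat) = star (v j) := by
  subst hE hA hB hC
  set M := mu j • -𝕃 - -𝕃s with hM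
  have hMunit : IsUnit M.det := by
    rw [← isUnit_iff_isUnit_det, hM, smul_neg, ← neg_sub', IsUnit.neg_iff]
    exact hinv
  have hrow : star (ell j) ᵥ* Chat = Pi.single j 1 ᵥ* M := by
    ext k
    have hne : mu j - lam k ≠ 0 := sub_ne_zero.mpr (hdisj j k)
    have hcol : (fun a => Chat a k) = w k := funext fun a => hW a k
    rw [single_one_vecMul, vecMul, hcol, hM]
    simp only [row_apply, Matrix.sub_apply, Matrix.smul_apply, Matrix.neg_apply, smul_eq_mul, h𝕃, h𝕃s]
    field_simp
    ring
  rw [← vecMul_vecMul, ← vecMul_vecMul, hrow, vecMul_vecMul _ M M⁻¹, mul_nonsing_inv _ hMunit,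
    vecMul_one, single_one_vecMul]
  ext k
  simp [hV]
end

section
/- If the tangential data are exact samples of the transfer function H(z) = C(zE − A)^{-1}B, then the Loewner matrix factors through the system: 𝕃_{ij} = −ℓ_i* C (μ_iE − A)^{-1} E (λ_jE − A)^{-1} B r_j for all i, j. -/
open Matrix

/-- The resolvent identity for the matrix pencil `zE − A`. -/
theorem Matrix.pencil_inv_sub_inv {ι R : Type*} [Fintype ι] [DecidableEq ι] [CommRing R]
    {E A : Matrix ι ι R} {x y : R} (hx : IsUnit (x • E - A)) (hy : IsUnit (y • E - A)) :
    (x • E - A)⁻¹ - (y • E - A)⁻¹ = (y - x) • ((x • E - A)⁻¹ * E * (y • E - A)⁻¹) := by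
  rw [Matrix.inv_sub_inv (iff_of_true hx hy), sub_sub_sub_cancel_right, ← sub_smul,
    Matrix.mul_smul, Matrix.smul_mul]

/-- If the tangential data are exact samples of `H(z) = C(zE − A)⁻¹B`, then
`𝕃ᵢⱼ = −ℓᵢ* C(μᵢE − A)⁻¹ E (λⱼE − A)⁻¹ B rⱼ`. -/
theorem loewner_exact_data_factorization
    (m p n ν ϱ : ℕ) (hm : 0 < m) (hp : 0 < p) (hn : 0 < n) (hν : 0 < ν) (hϱ : 0 < ϱ)
    (E A : Matrix (Fin n) (Fin n) ℂ)
    (B : Matrix (Fin n) (Fin m) ℂ) (C : Matrix (Fin p) (Fin n) ℂ)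
    (lam : Fin ϱ → ℂ) (mu : Fin ν → ℂ)
    (hdisj : ∀ i j, mu i ≠ lam j)
    (hlamE : ∀ j, IsUnit (lam j • E - A))
    (hmuE : ∀ i, IsUnit (mu i • E - A))
    (r : Fin ϱ → Fin m → ℂ) (ell : Fin ν → Fin p → ℂ)
    (w : Fin ϱ → Fin p → ℂ) (v : Fin ν → Fin m → ℂ)
    (hw : ∀ j, w j = (C * (lam j • E - A)⁻¹ * B) *ᵥ r j)
    (hv : ∀ i, star (v i) = star (ell i) ᵥ* (C * (mu i • E - A)⁻¹ * B))
    (𝕃 : Matrix (Fin ν) (Fin ϱ) ℂ)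
    (h𝕃 : ∀ i j, 𝕃 i j = (star (v i) ⬝ᵥ r j - star (ell i) ⬝ᵥ w j) / (mu i - lam j)) :
    ∀ i j, 𝕃 i j =
      -(star (ell i) ⬝ᵥ (C * (mu i • E - A)⁻¹ * E * (lam j • E - A)⁻¹ * B) *ᵥ r j) := by
  intro i j
  rw [h𝕃, div_eq_iff (sub_ne_zero.mpr (hdisj i j)), hv, hw, ← dotProduct_mulVec,
    ← dotProduct_sub, ← sub_mulVec, ← Matrix.sub_mul, ← Matrix.mul_sub,
    Matrix.pencil_inv_sub_inv (hmuE i) (hlamE j), Matrix.mul_smul, Matrix.smul_mul,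
    smul_mulVec, dotProduct_smul, smul_eq_mul]
  simp only [Matrix.mul_assoc]
  ring
end

section
/- If the tangential data are exact samples of the transfer function H(z) = C(zE − A)^{-1}B, then the shifted Loewner matrix factors through the system: (𝕃_s)_{ij} = −ℓ_i* C (μ_iE − A)^{-1} A (λ_jE − A)^{-1} B r_j for all i, j. -/
open Matrix

/-- A resolvent identity for the matrix pencil `z ↦ zE − A`. -/
theorem Matrix.smul_inv_pencil_sub_smul_inv_pencil {ι R : Type*} [Fintype ι] [DecidableEq ι]
    [CommRing R] (E A : Matrix ι ι R) {a b : R}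
    (ha : IsUnit (a • E - A)) (hb : IsUnit (b • E - A)) :
    a • (a • E - A)⁻¹ - b • (b • E - A)⁻¹ =
      -((a - b) • ((a • E - A)⁻¹ * A * (b • E - A)⁻¹)) := by
  have hA : a • (b • E - A) - b • (a • E - A) = -((a - b) • A) := by
    module
  rw [Matrix.isUnit_iff_isUnit_det] at ha hb
  calc a • (a • E - A)⁻¹ - b • (b • E - A)⁻¹
      = (a • E - A)⁻¹ * (a • (b • E - A) - b • (a • E - A)) * (b • E - A)⁻¹ := by
        rw [Matrix.mul_sub, Matrix.sub_mul, Matrix.mul_smul, Matrix.mul_smul, Matrix.smul_mul,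
          Matrix.smul_mul, Matrix.mul_nonsing_inv_cancel_right _ _ hb,
          Matrix.nonsing_inv_mul _ ha, Matrix.one_mul]
    _ = -((a - b) • ((a • E - A)⁻¹ * A * (b • E - A)⁻¹)) := by
        rw [hA, Matrix.mul_neg, Matrix.neg_mul, Matrix.mul_smul, Matrix.smul_mul]

/-- If the tangential data are exact samples of `H(z) = C(zE − A)⁻¹B`, then
`(𝕃ₛ)ᵢⱼ = −ℓᵢ* C(μᵢE − A)⁻¹ A (λⱼE − A)⁻¹ B rⱼ`. -/
theorem shifted_loewner_exact_data_factorization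
    (m p n ν ϱ : ℕ) (hm : 0 < m) (hp : 0 < p) (hn : 0 < n) (hν : 0 < ν) (hϱ : 0 < ϱ)
    (E A : Matrix (Fin n) (Fin n) ℂ)
    (B : Matrix (Fin n) (Fin m) ℂ) (C : Matrix (Fin p) (Fin n) ℂ)
    (lam : Fin ϱ → ℂ) (mu : Fin ν → ℂ)
    (hdisj : ∀ i j, mu i ≠ lam j)
    (hlamE : ∀ j, IsUnit (lam j • E - A))
    (hmuE : ∀ i, IsUnit (mu i • E - A))
    (r : Fin ϱ → Fin m → ℂ) (ell : Fin ν → Fin p → ℂ)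
    (w : Fin ϱ → Fin p → ℂ) (v : Fin ν → Fin m → ℂ)
    (hw : ∀ j, w j = (C * (lam j • E - A)⁻¹ * B) *ᵥ r j)
    (hv : ∀ i, star (v i) = star (ell i) ᵥ* (C * (mu i • E - A)⁻¹ * B))
    (𝕃s : Matrix (Fin ν) (Fin ϱ) ℂ)
    (h𝕃s : ∀ i j, 𝕃s i j =
      (mu i * (star (v i) ⬝ᵥ r j) - lam j * (star (ell i) ⬝ᵥ w j)) / (mu i - lam j)) :
    ∀ i j, 𝕃s i j =
      -(star (ell i) ⬝ᵥ (C * (mu i • E - A)⁻¹ * A * (lam j • E - A)⁻¹ * B) *ᵥ r j) := by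
  intro i j
  have hsub : mu i - lam j ≠ 0 := sub_ne_zero.mpr (hdisj i j)
  have key := congrArg (fun X => star (ell i) ⬝ᵥ (C * X * B) *ᵥ r j)
    (Matrix.smul_inv_pencil_sub_smul_inv_pencil E A (hmuE i) (hlamE j))
  simp only [Matrix.mul_sub, Matrix.sub_mul, Matrix.mul_neg, Matrix.neg_mul, Matrix.mul_smul,
    Matrix.smul_mul, Matrix.sub_mulVec, Matrix.neg_mulVec, Matrix.smul_mulVec, dotProduct_sub,
    dotProduct_neg, dotProduct_smul, smul_eq_mul, ← Matrix.mul_assoc] at key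
  rw [h𝕃s, hv, hw, ← dotProduct_mulVec, div_eq_iff hsub, key]
  ring
end

section
/- If the tangential data are exact samples of the transfer function H(z) = C(zE − A)^{-1}B, then for every z ∈ ℂ the Loewner pencil factors through the system: (z𝕃 − 𝕃_s)_{ij} = −ℓ_i* C (μ_iE − A)^{-1} (zE − A) (λ_jE − A)^{-1} B r_j for all i, j. Consequently, rank(z𝕃 − 𝕃_s) ≤ n for every z ∈ ℂ. -/
open Matrix

/-- Two-point resolvent identity for the matrix pencil `zE − A`. -/
theorem pencil_resolvent_identity {ι K : Type*} [Fintype ι] [DecidableEq ι] [Field K]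
    (E A : Matrix ι ι K) {a b : K} (ha : IsUnit (a • E - A)) (hb : IsUnit (b • E - A)) (z : K) :
    (a - b) • ((a • E - A)⁻¹ * (z • E - A) * (b • E - A)⁻¹) =
      (z - b) • (b • E - A)⁻¹ - (z - a) • (a • E - A)⁻¹ := by
  have hsplit : (a - b) • (z • E - A) = (z - b) • (a • E - A) - (z - a) • (b • E - A) := by
    module
  rw [isUnit_iff_isUnit_det] at ha hb
  rw [← smul_mul_assoc, ← mul_smul_comm, hsplit, mul_sub, sub_mul, mul_smul_comm,
    mul_smul_comm, nonsing_inv_mul _ ha, smul_mul_assoc, smul_mul_assoc, one_mul, mul_assoc,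
    mul_nonsing_inv _ hb, mul_one]

/-- If the tangential data are exact samples of `H(z) = C(zE − A)⁻¹B`, then for
every `z ∈ ℂ` the Loewner pencil factors through the system:
`(z𝕃 − 𝕃ₛ)ᵢⱼ = −ℓᵢ* C(μᵢE − A)⁻¹ (zE − A) (λⱼE − A)⁻¹ B rⱼ`, and consequently
`rank(z𝕃 − 𝕃ₛ) ≤ n`. -/
theorem loewner_pencil_exact_data_factorization_and_rank
    (m p n ν ϱ : ℕ) (hm : 0 < m) (hp : 0 < p) (hn : 0 < n) (hν : 0 < ν) (hϱ : 0 < ϱ)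
    (E A : Matrix (Fin n) (Fin n) ℂ)
    (B : Matrix (Fin n) (Fin m) ℂ) (C : Matrix (Fin p) (Fin n) ℂ)
    (lam : Fin ϱ → ℂ) (mu : Fin ν → ℂ)
    (hdisj : ∀ i j, mu i ≠ lam j)
    (hlamE : ∀ j, IsUnit (lam j • E - A))
    (hmuE : ∀ i, IsUnit (mu i • E - A))
    (r : Fin ϱ → Fin m → ℂ) (ell : Fin ν → Fin p → ℂ)
    (w : Fin ϱ → Fin p → ℂ) (v : Fin ν → Fin m → ℂ)
    (hw : ∀ j, w j = (C * (lam j • E - A)⁻¹ * B) *ᵥ r j)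
    (hv : ∀ i, star (v i) = star (ell i) ᵥ* (C * (mu i • E - A)⁻¹ * B))
    (𝕃 : Matrix (Fin ν) (Fin ϱ) ℂ)
    (h𝕃 : ∀ i j, 𝕃 i j = (star (v i) ⬝ᵥ r j - star (ell i) ⬝ᵥ w j) / (mu i - lam j))
    (𝕃s : Matrix (Fin ν) (Fin ϱ) ℂ)
    (h𝕃s : ∀ i j, 𝕃s i j =
      (mu i * (star (v i) ⬝ᵥ r j) - lam j * (star (ell i) ⬝ᵥ w j)) / (mu i - lam j)) :
    ∀ z : ℂ,
      (∀ i j, (z • 𝕃 - 𝕃s) i j =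
        -(star (ell i) ⬝ᵥ (C * (mu i • E - A)⁻¹ * (z • E - A) * (lam j • E - A)⁻¹ * B) *ᵥ r j)) ∧
      (z • 𝕃 - 𝕃s).rank ≤ n := by
  intro z
  have hfac : ∀ i j, (z • 𝕃 - 𝕃s) i j =
      -(star (ell i) ⬝ᵥ
        (C * (mu i • E - A)⁻¹ * (z • E - A) * (lam j • E - A)⁻¹ * B) *ᵥ r j) := by
    intro i j
    have hne : mu i - lam j ≠ 0 := sub_ne_zero.mpr (hdisj i j)
    have key := congrArg (fun X => star (ell i) ⬝ᵥ (C * X * B) *ᵥ r j)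
      (pencil_resolvent_identity E A (hmuE i) (hlamE j) z)
    simp only [Matrix.mul_sub, Matrix.sub_mul, Matrix.mul_smul, Matrix.smul_mul, sub_mulVec,
      smul_mulVec, dotProduct_sub, dotProduct_smul, smul_eq_mul, ← Matrix.mul_assoc] at key
    simp only [Matrix.sub_apply, Matrix.smul_apply, smul_eq_mul, h𝕃, h𝕃s, hv, hw,
      ← dotProduct_mulVec, Matrix.mul_sub, Matrix.sub_mul, Matrix.mul_smul, Matrix.smul_mul,
      sub_mulVec, smul_mulVec, dotProduct_sub, dotProduct_smul]
    field_simp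
    linear_combination key
  refine ⟨hfac, ?_⟩
  let O : Matrix (Fin ν) (Fin n) ℂ := of fun i => star (ell i) ᵥ* (C * (mu i • E - A)⁻¹)
  let R : Matrix (Fin n) (Fin ϱ) ℂ := of fun k j => (((lam j • E - A)⁻¹ * B) *ᵥ r j) k
  have hprod : z • 𝕃 - 𝕃s = -(O * (z • E - A)) * R := by
    ext i j
    have hO : (O * (z • E - A)) i = star (ell i) ᵥ* (C * (mu i • E - A)⁻¹ * (z • E - A)) := by
      rw [← vecMul_vecMul]
      rfl
    rw [hfac, Matrix.neg_mul, Matrix.neg_apply, Matrix.mul_assoc _ _ B,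
      ← mulVec_mulVec, dotProduct_mulVec, ← hO]
    rfl
  rw [hprod]
  exact (rank_mul_le_left _ _).trans (rank_le_width _)
end

section
/- If the tangential data are exact samples of the transfer function H(z) = C(zE − A)^{-1}B of a system of order n, then the rank of the Loewner matrix and of the shifted Loewner matrix are bounded by the order of the system: rank(𝕃) ≤ n and rank(𝕃_s) ≤ n. -/
open Matrix

/-- A matrix whose entries are values of a bilinear form on an `n`-dimensional space has rank at
most `n`. -/
theorem Matrix.rank_le_card_of_apply_eq_dotProduct_mulVec {K ι κ α : Type*} [Field K]
    [Fintype κ] [Fintype α] (L : Matrix ι κ K) (x : ι → α → K) (y : κ → α → K)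
    (F : Matrix α α K) (h : ∀ i j, L i j = x i ⬝ᵥ (F *ᵥ y j)) :
    L.rank ≤ Fintype.card α := by
  have hL : L = Matrix.of x * (F * (Matrix.of y)ᵀ) := by
    ext i j
    rw [h]
    rfl
  rw [hL]
  exact (Matrix.rank_mul_le_left _ _).trans (Matrix.rank_le_card_width _)

/-- If the tangential data are exact samples of `H(z) = C(zE − A)⁻¹B` of a
system of order `n`, then `rank(𝕃) ≤ n` and `rank(𝕃ₛ) ≤ n`. -/
theorem loewner_rank_le_order
    (m p n ν ϱ : ℕ) (hm : 0 < m) (hp : 0 < p) (hn : 0 < n) (hν : 0 < ν) (hϱ : 0 < ϱ)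
    (E A : Matrix (Fin n) (Fin n) ℂ)
    (B : Matrix (Fin n) (Fin m) ℂ) (C : Matrix (Fin p) (Fin n) ℂ)
    (lam : Fin ϱ → ℂ) (mu : Fin ν → ℂ)
    (hdisj : ∀ i j, mu i ≠ lam j)
    (hlamE : ∀ j, IsUnit (lam j • E - A))
    (hmuE : ∀ i, IsUnit (mu i • E - A))
    (r : Fin ϱ → Fin m → ℂ) (ell : Fin ν → Fin p → ℂ)
    (w : Fin ϱ → Fin p → ℂ) (v : Fin ν → Fin m → ℂ)
    (hw : ∀ j, w j = (C * (lam j • E - A)⁻¹ * B) *ᵥ r j)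
    (hv : ∀ i, star (v i) = star (ell i) ᵥ* (C * (mu i • E - A)⁻¹ * B))
    (𝕃 : Matrix (Fin ν) (Fin ϱ) ℂ)
    (h𝕃 : ∀ i j, 𝕃 i j = (star (v i) ⬝ᵥ r j - star (ell i) ⬝ᵥ w j) / (mu i - lam j))
    (𝕃s : Matrix (Fin ν) (Fin ϱ) ℂ)
    (h𝕃s : ∀ i j, 𝕃s i j =
      (mu i * (star (v i) ⬝ᵥ r j) - lam j * (star (ell i) ⬝ᵥ w j)) / (mu i - lam j)) :
    𝕃.rank ≤ n ∧ 𝕃s.rank ≤ n := by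
  set x : Fin ν → Fin n → ℂ := fun i => star (ell i) ᵥ* (C * (mu i • E - A)⁻¹) with hx
  set y : Fin ϱ → Fin n → ℂ := fun j => ((lam j • E - A)⁻¹ * B) *ᵥ r j with hy
  have hvr : ∀ i j, star (v i) ⬝ᵥ r j = x i ⬝ᵥ ((lam j • E - A) *ᵥ y j) := by
    intro i j
    have hdet := (Matrix.isUnit_iff_isUnit_det _).mp (hlamE j)
    rw [hv, hx, hy]
    simp only [Matrix.mulVec_mulVec, Matrix.mul_nonsing_inv_cancel_left _ _ hdet,
      Matrix.dotProduct_mulVec, Matrix.vecMul_vecMul]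
  have hlw : ∀ i j, star (ell i) ⬝ᵥ w j = x i ⬝ᵥ ((mu i • E - A) *ᵥ y j) := by
    intro i j
    have hdet := (Matrix.isUnit_iff_isUnit_det _).mp (hmuE i)
    rw [hw, hx, hy]
    simp only [Matrix.dotProduct_mulVec, Matrix.vecMul_vecMul,
      Matrix.nonsing_inv_mul_cancel_right _ _ hdet, Matrix.mul_assoc]
  have hne : ∀ i j, mu i - lam j ≠ 0 := fun i j => sub_ne_zero.mpr (hdisj i j)
  constructor
  · refine (Matrix.rank_le_card_of_apply_eq_dotProduct_mulVec 𝕃 x y (-E) fun i j => ?_).trans_eq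
      (Fintype.card_fin n)
    rw [h𝕃, hvr, hlw, div_eq_iff (hne i j)]
    simp only [Matrix.sub_mulVec, Matrix.smul_mulVec, Matrix.neg_mulVec, dotProduct_sub,
      dotProduct_smul, dotProduct_neg, smul_eq_mul]
    ring
  · refine (Matrix.rank_le_card_of_apply_eq_dotProduct_mulVec 𝕃s x y (-A) fun i j => ?_).trans_eq
      (Fintype.card_fin n)
    rw [h𝕃s, hvr, hlw, div_eq_iff (hne i j)]
    simp only [Matrix.sub_mulVec, Matrix.smul_mulVec, Matrix.neg_mulVec, dotProduct_sub,
      dotProduct_smul, dotProduct_neg, smul_eq_mul]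
    ring
end
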